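/- The function V_{2,H} is continuously differentiable on (0,+∞) and its derivative satisfies lim_{t→0⁺} V'_{2,H}(t)/t^{2H−1} = 2H. -/

import Mathlib

open MeasureTheory Set Filter
open scoped Topology

/-- The incomplete gamma-type integral `∫₀ˣ e^{cs} s^a ds`. -/
noncomputable def expRpowPrimitive (a c x : ℝ) : ℝ :=
  ∫ s in (0:ℝ)..x, Real.exp (c * s) * s ^ a

lemma intervalIntegrable_exp_mul_rpow {a : ℝ} (ha : -1 < a) (c x y : ℝ) :
    IntervalIntegrable (fun s : ℝ => Real.exp (c * s) * s ^ a) volume x y :=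
  (intervalIntegral.intervalIntegrable_rpow' ha).continuousOn_mul
    (Continuous.continuousOn (by fun_prop))

lemma continuous_expRpowPrimitive {a : ℝ} (ha : -1 < a) (c : ℝ) :
    Continuous (expRpowPrimitive a c) :=
  intervalIntegral.continuous_primitive
    (fun x y => intervalIntegrable_exp_mul_rpow ha c x y) 0

lemma expRpowPrimitive_zero (a c : ℝ) : expRpowPrimitive a c 0 = 0 := by
  simp [expRpowPrimitive]

lemma tendsto_expRpowPrimitive_div_rpow {a : ℝ} (ha : -1 < a) (c : ℝ) :
    Tendsto (fun t => expRpowPrimitive a c t / t ^ (a + 1)) (𝓝[>] (0:ℝ)) (𝓝 (1 / (a + 1))) := by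
  have ha' : 0 < a + 1 := by linarith
  have hI (t : ℝ) : ∫ s in (0:ℝ)..t, s ^ a = t ^ (a + 1) / (a + 1) := by
    rw [integral_rpow (Or.inl ha), Real.zero_rpow ha'.ne', sub_zero]
  have lim (d : ℝ) :
      Tendsto (fun t : ℝ => Real.exp (d * t) / (a + 1)) (𝓝[>] (0:ℝ)) (𝓝 (1 / (a + 1))) := by
    have h : Continuous (fun t : ℝ => Real.exp (d * t) / (a + 1)) := by fun_prop
    simpa using (h.tendsto 0).mono_left nhdsWithin_le_nhds
  have bound {s t : ℝ} (hs : s ∈ Icc 0 t) : |c * s| ≤ |c| * t := by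
    rw [abs_mul, abs_of_nonneg hs.1]
    exact mul_le_mul_of_nonneg_left hs.2 (abs_nonneg c)
  refine tendsto_of_tendsto_of_tendsto_of_le_of_le' (lim (-|c|)) (lim |c|) ?_ ?_
  · filter_upwards [self_mem_nhdsWithin] with t (ht : 0 < t)
    rw [le_div_iff₀ (Real.rpow_pos_of_pos ht _)]
    calc Real.exp (-|c| * t) / (a + 1) * t ^ (a + 1)
        = ∫ s in (0:ℝ)..t, Real.exp (-|c| * t) * s ^ a := by
          rw [intervalIntegral.integral_const_mul, hI]; ring
      _ ≤ expRpowPrimitive a c t := by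
          refine intervalIntegral.integral_mono_on ht.le
            ((intervalIntegral.intervalIntegrable_rpow' ha).const_mul _)
            (intervalIntegrable_exp_mul_rpow ha c 0 t) fun s hs => ?_
          have := Real.rpow_nonneg hs.1 a
          refine mul_le_mul_of_nonneg_right (Real.exp_le_exp.2 ?_) this
          linarith [(abs_le.1 (bound hs)).1]
  · filter_upwards [self_mem_nhdsWithin] with t (ht : 0 < t)
    rw [div_le_iff₀ (Real.rpow_pos_of_pos ht _)]
    calc expRpowPrimitive a c t ≤ ∫ s in (0:ℝ)..t, Real.exp (|c| * t) * s ^ a := by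
          refine intervalIntegral.integral_mono_on ht.le
            (intervalIntegrable_exp_mul_rpow ha c 0 t)
            ((intervalIntegral.intervalIntegrable_rpow' ha).const_mul _) fun s hs => ?_
          have := Real.rpow_nonneg hs.1 a
          exact mul_le_mul_of_nonneg_right (Real.exp_le_exp.2 (abs_le.1 (bound hs)).2) this
      _ = Real.exp (|c| * t) / (a + 1) * t ^ (a + 1) := by
          rw [intervalIntegral.integral_const_mul, hI]; ring

lemma integral_exp_mul_abs_sub_rpow {a : ℝ} (ha : -1 < a) (θ : ℝ) {u t : ℝ}
    (hu : u ∈ Icc 0 t) :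
    ∫ v in (0:ℝ)..t, Real.exp ((u + v) / θ) * |u - v| ^ a =
      Real.exp (2 * u / θ) *
        (expRpowPrimitive a (-1 / θ) u + expRpowPrimitive a (1 / θ) (t - u)) := by
  have e1 : EqOn (fun v => Real.exp (2 * u / θ) *
      (Real.exp (-1 / θ * (u - v)) * (u - v) ^ a))
      (fun v => Real.exp ((u + v) / θ) * |u - v| ^ a) (uIcc 0 u) := by
    intro v hv
    rw [uIcc_of_le hu.1] at hv
    dsimp only
    rw [abs_of_nonneg (by linarith [hv.2]), ← mul_assoc, ← Real.exp_add]
    congr 2; ring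
  have e2 : EqOn (fun v => Real.exp (2 * u / θ) *
      (Real.exp (1 / θ * (v - u)) * (v - u) ^ a))
      (fun v => Real.exp ((u + v) / θ) * |u - v| ^ a) (uIcc u t) := by
    intro v hv
    rw [uIcc_of_le hu.2] at hv
    dsimp only
    rw [abs_of_nonpos (by linarith [hv.1]), ← mul_assoc, ← Real.exp_add, neg_sub]
    congr 2; ring
  have i1 : IntervalIntegrable (fun v => Real.exp ((u + v) / θ) * |u - v| ^ a) volume 0 u := by
    refine IntervalIntegrable.congr (e1.mono uIoc_subset_uIcc) ?_
    have := (intervalIntegrable_exp_mul_rpow ha (-1 / θ) u 0).comp_sub_left u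
    simp only [sub_self, sub_zero] at this
    exact this.const_mul _
  have i2 : IntervalIntegrable (fun v => Real.exp ((u + v) / θ) * |u - v| ^ a) volume u t := by
    refine IntervalIntegrable.congr (e2.mono uIoc_subset_uIcc) ?_
    have := (intervalIntegrable_exp_mul_rpow ha (1 / θ) 0 (t - u)).comp_sub_right u
    simp only [zero_add, sub_add_cancel] at this
    exact this.const_mul _
  rw [← intervalIntegral.integral_add_adjacent_intervals i1 i2,
    ← intervalIntegral.integral_congr e1, ← intervalIntegral.integral_congr e2,
    intervalIntegral.integral_const_mul, intervalIntegral.integral_const_mul, mul_add,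
    intervalIntegral.integral_comp_sub_left (fun s => Real.exp (-1 / θ * s) * s ^ a),
    intervalIntegral.integral_comp_sub_right (fun s => Real.exp (1 / θ * s) * s ^ a)]
  simp [expRpowPrimitive]

lemma exp_mul_integral_integral_exp_mul_abs_sub_rpow {a : ℝ} (ha : -1 < a) (θ : ℝ) {t : ℝ}
    (ht : 0 ≤ t) :
    Real.exp (-2 * t / θ) *
      ∫ u in (0:ℝ)..t, ∫ v in (0:ℝ)..t, Real.exp ((u + v) / θ) * |u - v| ^ a =
    Real.exp (-2 * t / θ) *
        (∫ u in (0:ℝ)..t, Real.exp (2 * u / θ) * expRpowPrimitive a (-1 / θ) u) +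
      ∫ w in (0:ℝ)..t, Real.exp (-2 * w / θ) * expRpowPrimitive a (1 / θ) w := by
  have hK := continuous_expRpowPrimitive ha (-1 / θ)
  have hL := continuous_expRpowPrimitive ha (1 / θ)
  have h := intervalIntegral.integral_congr (μ := volume) (a := 0) (b := t)
    (f := fun u => ∫ v in (0:ℝ)..t, Real.exp ((u + v) / θ) * |u - v| ^ a)
    (g := fun u => Real.exp (2 * u / θ) * expRpowPrimitive a (-1 / θ) u +
      Real.exp (2 * u / θ) * expRpowPrimitive a (1 / θ) (t - u)) (fun u hu => by
        rw [uIcc_of_le ht] at hu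
        simp only [integral_exp_mul_abs_sub_rpow ha θ hu, mul_add])
  rw [h, intervalIntegral.integral_add
    (Continuous.intervalIntegrable (by fun_prop) _ _)
    (Continuous.intervalIntegrable (by fun_prop) _ _), mul_add]
  congr 1
  have h2 := intervalIntegral.integral_comp_sub_left (a := 0) (b := t)
    (fun w => Real.exp (-2 * w / θ) * expRpowPrimitive a (1 / θ) w) t
  rw [sub_self, sub_zero] at h2
  rw [← h2, ← intervalIntegral.integral_const_mul]
  refine intervalIntegral.integral_congr fun u _ => ?_
  rw [← mul_assoc, ← Real.exp_add]
  congr 2; ring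

/-- The variance `V_{2,H}` of the fractional Ornstein–Uhlenbeck process is continuously
differentiable on `(0,∞)` and `lim_{t→0⁺} V'_{2,H}(t)/t^{2H-1} = 2H`. -/
theorem stmt_3 (H θ : ℝ) (hH : H ∈ Set.Ioo (1/2 : ℝ) 1) (hθ : 0 < θ)
    (V : ℝ → ℝ)
    (hV : ∀ t : ℝ, V t = H * (2*H - 1) * Real.exp (-2*t/θ) *
      ∫ u in (0:ℝ)..t, ∫ v in (0:ℝ)..t, Real.exp ((u+v)/θ) * |u - v| ^ (2*H - 2)) :
    (∀ t ∈ Set.Ioi (0:ℝ), DifferentiableAt ℝ V t) ∧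
    ContinuousOn (deriv V) (Set.Ioi 0) ∧
    Tendsto (fun t => deriv V t / t ^ (2*H - 1)) (𝓝[>] (0:ℝ)) (𝓝 (2*H)) := by
  obtain ⟨hH1, hH2⟩ := hH
  have ha : -1 < 2 * H - 2 := by linarith
  have hK := continuous_expRpowPrimitive ha (-1 / θ)
  have hL := continuous_expRpowPrimitive ha (1 / θ)
  have hKt := tendsto_expRpowPrimitive_div_rpow ha (-1 / θ)
  have hLt := tendsto_expRpowPrimitive_div_rpow ha (1 / θ)
  have hK0 := expRpowPrimitive_zero (2 * H - 2) (-1 / θ)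
  rw [show 2 * H - 2 + 1 = 2 * H - 1 by ring] at hKt hLt
  set K := expRpowPrimitive (2 * H - 2) (-1 / θ)
  set L := expRpowPrimitive (2 * H - 2) (1 / θ)
  set C := H * (2 * H - 1)
  let A : ℝ → ℝ := fun t => ∫ u in (0:ℝ)..t, Real.exp (2 * u / θ) * K u
  let E : ℝ → ℝ := fun t => Real.exp (-2 * t / θ)
  have hE : Continuous E := by fun_prop
  have hVeq : ∀ t : ℝ, 0 < t → V t = C * (E t * A t + ∫ w in (0:ℝ)..t, E w * L w) := by
    intro t ht
    rw [hV, mul_assoc, exp_mul_integral_integral_exp_mul_abs_sub_rpow ha θ ht.le]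
  have hA (t : ℝ) : HasDerivAt A (Real.exp (2 * t / θ) * K t) t :=
    intervalIntegral.integral_hasDerivAt_right
      (Continuous.intervalIntegrable (by fun_prop) _ _)
      (Continuous.stronglyMeasurableAtFilter (by fun_prop) _ _)
      (Continuous.continuousAt (by fun_prop))
  have hAc : Continuous A := continuous_iff_continuousAt.2 fun t => (hA t).continuousAt
  let D : ℝ → ℝ := fun t => C * (-2 / θ * (E t * A t) + K t + E t * L t)
  have hderiv : ∀ t : ℝ, 0 < t → HasDerivAt V (D t) t := by
    intro t ht
    have hE' : HasDerivAt E (E t * (-2 / θ)) t := by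
      have h := (((hasDerivAt_id t).const_mul (-2)).div_const θ).exp
      exact h.congr_deriv (by simp [E])
    have hB : HasDerivAt (fun t => ∫ w in (0:ℝ)..t, E w * L w) (E t * L t) t :=
      intervalIntegral.integral_hasDerivAt_right
        (Continuous.intervalIntegrable (by fun_prop) _ _)
        (Continuous.stronglyMeasurableAtFilter (by fun_prop) _ _)
        (Continuous.continuousAt (by fun_prop))
    have h := ((hE'.mul (hA t)).add hB).const_mul C
    have hexp : E t * Real.exp (2 * t / θ) = 1 := by
      rw [← Real.exp_add, ← Real.exp_zero]; congr 1; ring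
    refine (h.congr_deriv ?_).congr_of_eventuallyEq ?_
    · linear_combination C * K t * hexp
    · filter_upwards [lt_mem_nhds ht] with s hs using hVeq s hs
  refine ⟨fun t ht => (hderiv t ht).differentiableAt, ?_, ?_⟩
  · have hD : Continuous D := by fun_prop
    exact hD.continuousOn.congr fun t ht => (hderiv t ht).deriv
  · have hA0 : Tendsto (fun t => A t / t ^ (2 * H - 1)) (𝓝[>] (0:ℝ)) (𝓝 0) := by
      have h1 : Tendsto (fun t => t⁻¹ * A t) (𝓝[>] (0:ℝ)) (𝓝 0) := by
        have h := (hA 0).tendsto_slope_zero_right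
        simpa [A, hK0] using h
      have h2 : Tendsto (fun t : ℝ => t ^ (2 - 2 * H)) (𝓝[>] (0:ℝ)) (𝓝 0) := by
        have h := (Real.continuousAt_rpow_const 0 (2 - 2 * H) (Or.inr (by linarith))).tendsto
        rw [Real.zero_rpow (by linarith)] at h
        exact h.mono_left nhdsWithin_le_nhds
      have h := h1.mul h2
      rw [mul_zero] at h
      refine h.congr' ?_
      filter_upwards [self_mem_nhdsWithin] with t (ht : 0 < t)
      rw [show 2 - 2 * H = 1 - (2 * H - 1) by ring, Real.rpow_sub ht, Real.rpow_one]
      field_simp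
    have hE0 : Tendsto E (𝓝[>] (0:ℝ)) (𝓝 1) := by
      have h := (hE.tendsto 0).mono_left (nhdsWithin_le_nhds (s := Ioi 0))
      simpa [E] using h
    have h := ((((hE0.mul hA0).const_mul (-2 / θ)).add hKt).add (hE0.mul hLt)).const_mul C
    have hval : C * (-2 / θ * (1 * 0) + 1 / (2 * H - 1) + 1 * (1 / (2 * H - 1))) = 2 * H := by
      have : (2 * H - 1) * (1 / (2 * H - 1)) = 1 := mul_one_div_cancel (by linarith)
      linear_combination 2 * H * this
    rw [hval] at h
    refine h.congr' ?_
    filter_upwards [self_mem_nhdsWithin] with t (ht : 0 < t)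
    rw [(hderiv t ht).deriv]
    simp only [D]
    ring
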